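/- Under the standing assumptions (L convex in v, bounds (1/N_1)|v|^q − ν_t ≤ L ≤ N_1|v|^q + ν_t with ν ≥ 1), if γ: [0,t_0] → ℝ^d is an optimal path for m(x_0,t_0), then for any 0 ≤ s < t ≤ t_0, |γ(s)−γ(t)| ≤ (t−s)^{1−1/q} · N_1^{1/q} · (m(x_0,t_0) + 4∫_0^{t_0} ν_r dr)^{1/q}. -/

import Mathlib

open MeasureTheory

/-- The action of a curve `γ` (with velocity `dγ`) on the time interval `[s,t]`. -/
noncomputable def curveAction (d : ℕ) (L : (Fin d → ℝ) → ℝ → (Fin d → ℝ) → ℝ)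
    (γ dγ : ℝ → (Fin d → ℝ)) (s t : ℝ) : ℝ :=
  ∫ r in s..t, L (γ r) r (dγ r)

/-- The metric distance `m(y,s;x,t)`: the infimal action over curves from `(y,s)` to `(x,t)`. -/
noncomputable def mdist (d : ℕ) (L : (Fin d → ℝ) → ℝ → (Fin d → ℝ) → ℝ)
    (y : Fin d → ℝ) (s : ℝ) (x : Fin d → ℝ) (t : ℝ) : ℝ :=
  sInf {A : ℝ | ∃ γ dγ : ℝ → (Fin d → ℝ),
    (∀ r ∈ Set.Icc s t, HasDerivAt γ (dγ r) r) ∧ γ s = y ∧ γ t = x ∧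
    IntervalIntegrable (fun r => L (γ r) r (dγ r)) volume s t ∧
    A = curveAction d L γ dγ s t}

/-- Hölder's inequality against the constant function `1` on an interval. -/
lemma integral_norm_le_rpow_mul_integral_norm_rpow {E : Type*} [NormedAddCommGroup E]
    {q s t : ℝ} (hq : 1 < q) (hst : s ≤ t) {f : ℝ → E}
    (hf : AEStronglyMeasurable f (volume.restrict (Set.Ioc s t)))
    (hfq : IntervalIntegrable (fun r => ‖f r‖ ^ q) volume s t) :
    ∫ r in s..t, ‖f r‖ ≤ (t - s) ^ (1 - 1 / q) * (∫ r in s..t, ‖f r‖ ^ q) ^ (1 / q) := by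
  have hq0 : 0 < q := by linarith
  have hconj : q.HolderConjugate q.conjExponent := Real.HolderConjugate.conjExponent hq
  rw [intervalIntegrable_iff_integrableOn_Ioc_of_le hst] at hfq
  have hmem : MemLp (fun r => ‖f r‖) (ENNReal.ofReal q) (volume.restrict (Set.Ioc s t)) := by
    refine MemLp.norm ?_
    rw [← integrable_norm_rpow_iff hf (by simpa using hq0) ENNReal.ofReal_ne_top,
      ENNReal.toReal_ofReal hq0.le]
    exact hfq
  have h := integral_mul_le_Lp_mul_Lq_of_nonneg (μ := volume.restrict (Set.Ioc s t)) hconj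
    (Filter.Eventually.of_forall fun r => norm_nonneg (f r))
    (Filter.Eventually.of_forall fun _ => zero_le_one) hmem
    (memLp_const (1 : ℝ))
  have hexp : 1 / q.conjExponent = 1 - 1 / q := by
    have := hconj.inv_add_inv_eq_one
    simp only [one_div]
    linarith
  rw [intervalIntegral.integral_of_le hst, intervalIntegral.integral_of_le hst, ← hexp, mul_comm]
  simpa [hst] using h

/-- A differentiable curve whose speed has an integrable `q`-th power satisfies the
`(1 - 1/q)`-Hölder bound given by the `L^q` norm of its speed. -/
lemma norm_sub_le_rpow_mul_integral_norm_deriv_rpow {E : Type*} [NormedAddCommGroup E]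
    [NormedSpace ℝ E] [CompleteSpace E] {q s t : ℝ} (hq : 1 < q) (hst : s ≤ t)
    {γ dγ : ℝ → E} (hγ : ∀ r ∈ Set.Icc s t, HasDerivAt γ (dγ r) r)
    (hm : AEStronglyMeasurable dγ (volume.restrict (Set.Ioc s t)))
    (hint : IntervalIntegrable (fun r => ‖dγ r‖ ^ q) volume s t) :
    ‖γ s - γ t‖ ≤ (t - s) ^ (1 - 1 / q) * (∫ r in s..t, ‖dγ r‖ ^ q) ^ (1 / q) := by
  have hdγ : IntervalIntegrable dγ volume s t := by
    refine (intervalIntegrable_const (c := (1 : ℝ)).add hint).mono_fun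
      (by rwa [Set.uIoc_of_le hst]) (Filter.Eventually.of_forall fun r => ?_)
    have h0 : 0 ≤ ‖dγ r‖ ^ q := by positivity
    dsimp only
    rw [Real.norm_of_nonneg (by linarith)]
    rcases le_total ‖dγ r‖ 1 with h | h
    · linarith
    · linarith [Real.self_le_rpow_of_one_le h hq.le]
  rw [norm_sub_rev, ← intervalIntegral.integral_eq_sub_of_hasDerivAt
    (by rwa [Set.uIcc_of_le hst]) hdγ]
  exact (intervalIntegral.norm_integral_le_integral_norm hst).trans
    (integral_norm_le_rpow_mul_integral_norm_rpow hq hst hm hint)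

/-- Rough Hölder regularity of optimal paths: if `γ` is an optimal
path for `m(x₀,t₀)`, then for `0 ≤ s < t ≤ t₀`,
`|γ(s) - γ(t)| ≤ (t-s)^{1-1/q} N₁^{1/q} (m(x₀,t₀) + 4∫_0^{t₀} ν)^{1/q}`. -/
theorem stmt6 (d : ℕ) (hd : 1 ≤ d) (q N₁ : ℝ) (hq : 1 < q) (hN₁ : 1 < N₁)
    (L : (Fin d → ℝ) → ℝ → (Fin d → ℝ) → ℝ)
    (hLconv : ∀ x : Fin d → ℝ, ∀ t : ℝ, ConvexOn ℝ Set.univ (fun v => L x t v))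
    (ν : ℝ → ℝ) (hν1 : ∀ r : ℝ, 1 ≤ ν r) (hνloc : LocallyIntegrable ν volume)
    (hLlow : ∀ (x : Fin d → ℝ) (t : ℝ) (v : Fin d → ℝ),
      (1 / N₁) * ‖v‖ ^ q - ν t ≤ L x t v)
    (hLup : ∀ (x : Fin d → ℝ) (t : ℝ) (v : Fin d → ℝ),
      L x t v ≤ N₁ * ‖v‖ ^ q + ν t)
    (hosc : ∀ (x y v : Fin d → ℝ) (t' s' : ℝ), |L x t' v - L y s' v| ≤ ν t' + ν s')
    (x₀ : Fin d → ℝ) (t₀ : ℝ) (ht₀ : 0 < t₀)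
    (γ dγ : ℝ → (Fin d → ℝ))
    (hγderiv : ∀ r ∈ Set.Icc (0 : ℝ) t₀, HasDerivAt γ (dγ r) r)
    (hγ0 : γ 0 = 0) (hγt₀ : γ t₀ = x₀)
    (hγint : IntervalIntegrable (fun r => L (γ r) r (dγ r)) volume 0 t₀)
    (hopt : curveAction d L γ dγ 0 t₀ = mdist d L 0 0 x₀ t₀)
    (s t : ℝ) (hs : 0 ≤ s) (hst : s < t) (ht : t ≤ t₀) :
    ‖γ s - γ t‖ ≤ (t - s) ^ (1 - 1 / q) * N₁ ^ (1 / q) *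
      (mdist d L 0 0 x₀ t₀ + 4 * ∫ r in (0:ℝ)..t₀, ν r) ^ (1 / q) := by
  have hN : 0 < N₁ := by linarith
  have hq0 : 0 < q := by linarith
  have hν : ∀ a b, IntervalIntegrable ν volume a b := fun a b =>
    (hνloc.integrableOn_isCompact isCompact_uIcc).intervalIntegrable
  have hm : AEStronglyMeasurable dγ (volume.restrict (Set.Ioc 0 t₀)) := by
    refine (stronglyMeasurable_deriv γ).aestronglyMeasurable.congr ?_
    filter_upwards [ae_restrict_mem measurableSet_Ioc] with r hr
    exact (hγderiv r (Set.Ioc_subset_Icc_self hr)).deriv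
  have hbound : ∀ r, ‖dγ r‖ ^ q ≤ N₁ * (L (γ r) r (dγ r) + ν r) := fun r => by
    have h := hLlow (γ r) r (dγ r)
    rw [one_div_mul_eq_div, sub_le_iff_le_add, div_le_iff₀ hN] at h
    linarith
  have hpos : ∀ r, 0 ≤ ‖dγ r‖ ^ q := fun r => by positivity
  have hsum : IntervalIntegrable (fun r => N₁ * (L (γ r) r (dγ r) + ν r)) volume 0 t₀ :=
    (hγint.add (hν 0 t₀)).const_mul N₁
  have hint : IntervalIntegrable (fun r => ‖dγ r‖ ^ q) volume 0 t₀ := by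
    refine hsum.mono_fun ?_ (Filter.Eventually.of_forall fun r => ?_)
    · rw [Set.uIoc_of_le ht₀.le]
      exact (hm.norm.aemeasurable.pow_const q).aestronglyMeasurable
    · dsimp only
      rw [Real.norm_of_nonneg (hpos r), Real.norm_of_nonneg ((hpos r).trans (hbound r))]
      exact hbound r
  have hν0 : 0 ≤ ∫ r in (0 : ℝ)..t₀, ν r :=
    intervalIntegral.integral_nonneg ht₀.le fun r _ => zero_le_one.trans (hν1 r)
  have henergy : ∫ r in s..t, ‖dγ r‖ ^ q ≤
      N₁ * (mdist d L 0 0 x₀ t₀ + 4 * ∫ r in (0 : ℝ)..t₀, ν r) := by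
    calc ∫ r in s..t, ‖dγ r‖ ^ q ≤ ∫ r in (0 : ℝ)..t₀, ‖dγ r‖ ^ q :=
          intervalIntegral.integral_mono_interval hs hst.le ht
            (Filter.Eventually.of_forall hpos) hint
      _ ≤ ∫ r in (0 : ℝ)..t₀, N₁ * (L (γ r) r (dγ r) + ν r) :=
          intervalIntegral.integral_mono ht₀.le hint hsum hbound
      _ = N₁ * (mdist d L 0 0 x₀ t₀ + ∫ r in (0 : ℝ)..t₀, ν r) := by
          rw [intervalIntegral.integral_const_mul, intervalIntegral.integral_add hγint (hν 0 t₀),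
            ← hopt, curveAction]
      _ ≤ _ := by gcongr; linarith
  have hE0 : 0 ≤ ∫ r in s..t, ‖dγ r‖ ^ q :=
    intervalIntegral.integral_nonneg hst.le fun r _ => hpos r
  have hsub : Set.Icc s t ⊆ Set.Icc 0 t₀ := Set.Icc_subset_Icc hs ht
  have hholder := norm_sub_le_rpow_mul_integral_norm_deriv_rpow hq hst.le
    (fun r hr => hγderiv r (hsub hr))
    (hm.mono_measure (Measure.restrict_mono (Set.Ioc_subset_Ioc hs ht) le_rfl))
    (hint.mono_set (by rwa [Set.uIcc_of_le hst.le, Set.uIcc_of_le ht₀.le]))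
  refine hholder.trans ?_
  rw [mul_assoc, ← Real.mul_rpow hN.le
    (nonneg_of_mul_nonneg_right (hE0.trans henergy) hN)]
  have : 0 ≤ t - s := by linarith
  gcongr
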